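/- Let k be a commutative ring and G a group, and let k denote the trivial representation of G over k in the category Rep k G of k-linear representations of G. Then the Yoneda Ext algebra Ext^*_{Rep k G}(k, k) = ⊕_{p ≥ 0} Ext^p(k, k) is graded-commutative: for every f ∈ Ext^p(k, k) and g ∈ Ext^q(k, k), the Yoneda composition satisfies g ∘ f = (−1)^{pq} f ∘ g in Ext^{p+q}(k, k). -/

import Mathlib

open CategoryTheory CategoryTheory.Abelian

universe u

namespace CategoryTheory

open Limits MonoidalCategory

section

universe w v v' u'

variable {C : Type u} [Category.{v} C] [Abelian C] [HasExt.{w} C]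

/-- The connecting classes of a `3 × 3` diagram with short exact rows and columns anticommute. -/
lemma ShortComplex.extClass_comp_extClass_of_three_by_three {S₁ S₂ S₃ : ShortComplex C}
    (φ : S₁ ⟶ S₂) (ψ : S₂ ⟶ S₃)
    (z₁ : φ.τ₁ ≫ ψ.τ₁ = 0) (z₂ : φ.τ₂ ≫ ψ.τ₂ = 0) (z₃ : φ.τ₃ ≫ ψ.τ₃ = 0)
    (r₁ : S₁.ShortExact) (r₂ : S₂.ShortExact) (r₃ : S₃.ShortExact)
    (c₁ : (ShortComplex.mk φ.τ₁ ψ.τ₁ z₁).ShortExact)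
    (c₂ : (ShortComplex.mk φ.τ₂ ψ.τ₂ z₂).ShortExact)
    (c₃ : (ShortComplex.mk φ.τ₃ ψ.τ₃ z₃).ShortExact) :
    c₃.extClass.comp r₁.extClass (c := 2) rfl =
      -r₃.extClass.comp c₁.extClass (c := 2) rfl := by
  have : Mono φ.τ₁ := c₁.mono_f
  have : Mono φ.τ₂ := c₂.mono_f
  have : Mono φ.τ₃ := c₃.mono_f
  have : Epi ψ.τ₁ := c₁.epi_g
  have : Epi ψ.τ₃ := c₃.epi_g
  have := r₁.mono_f
  have := r₁.epi_g
  have := r₂.mono_f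
  have := r₂.epi_g
  have := r₃.mono_f
  let d : S₂.X₂ ⟶ S₃.X₃ := S₂.g ≫ ψ.τ₃
  have hd : d = ψ.τ₂ ≫ S₃.g := ψ.comm₂₃.symm
  let ι := kernel.ι d
  obtain ⟨pr₁, hpr₁⟩ : ∃ pr : kernel d ⟶ S₁.X₃, pr ≫ φ.τ₃ = ι ≫ S₂.g :=
    ⟨c₃.exact.lift (ι ≫ S₂.g) ((Category.assoc _ _ _).trans (kernel.condition d)),
      c₃.exact.lift_f _ _⟩
  obtain ⟨pr₂, hpr₂⟩ : ∃ pr : kernel d ⟶ S₃.X₁, pr ≫ S₃.f = ι ≫ ψ.τ₂ :=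
    ⟨r₃.exact.lift (ι ≫ ψ.τ₂) (by rw [Category.assoc, ← hd]; exact kernel.condition d),
      r₃.exact.lift_f _ _⟩
  let s₁ : S₁.X₂ ⟶ kernel d := kernel.lift d φ.τ₂ (by rw [hd, reassoc_of% z₂, zero_comp])
  let s₂ : S₂.X₁ ⟶ kernel d := kernel.lift d S₂.f (by simp [d])
  have hs₁ : s₁ ≫ ι = φ.τ₂ := kernel.lift_ι _ _ _
  have hs₂ : s₂ ≫ ι = S₂.f := kernel.lift_ι _ _ _
  have h₁₁ : s₁ ≫ pr₁ = S₁.g := by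
    rw [← cancel_mono φ.τ₃, Category.assoc, hpr₁, reassoc_of% hs₁, φ.comm₂₃]
  have h₁₂ : s₁ ≫ pr₂ = 0 := by
    rw [← cancel_mono S₃.f, Category.assoc, hpr₂, reassoc_of% hs₁, z₂, zero_comp]
  have h₂₁ : s₂ ≫ pr₁ = 0 := by
    rw [← cancel_mono φ.τ₃, Category.assoc, hpr₁, reassoc_of% hs₂, S₂.zero, zero_comp]
  have h₂₂ : s₂ ≫ pr₂ = ψ.τ₁ := by
    rw [← cancel_mono S₃.f, Category.assoc, hpr₂, reassoc_of% hs₂, ψ.comm₁₂]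
  have hs : S₁.f ≫ s₁ = φ.τ₁ ≫ s₂ := by
    rw [← cancel_mono ι, Category.assoc, hs₁, Category.assoc, hs₂, φ.comm₁₂]
  let S : ShortComplex C := .mk ι d (kernel.condition d)
  have hS : S.ShortExact :=
    { exact := ShortComplex.exact_of_f_is_kernel _ (kernelIsKernel d)
      mono_f := inferInstanceAs (Mono (kernel.ι d))
      epi_g := inferInstanceAs (Epi (S₂.g ≫ ψ.τ₃)) }
  let Θ : ShortComplex C := .mk (S₁.f ≫ s₁) (biprod.lift pr₁ pr₂) (by
    ext
    · simp [h₁₁]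
    · simp [h₁₂])
  have hΘ : Θ.ShortExact :=
    { exact := ShortComplex.exact_of_f_is_kernel _ <|
        KernelFork.IsLimit.ofι' _ _ fun {W} k hk ↦ by
          have hk₁ : k ≫ pr₁ = 0 := by simpa [Θ] using hk =≫ biprod.fst
          have hk₂ : k ≫ pr₂ = 0 := by simpa [Θ] using hk =≫ biprod.snd
          let x := r₂.exact.lift (k ≫ ι) (by rw [Category.assoc, ← hpr₁, reassoc_of% hk₁, zero_comp])
          have hx : x ≫ S₂.f = k ≫ ι := r₂.exact.lift_f _ _
          have hx' : x ≫ ψ.τ₁ = 0 := by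
            rw [← cancel_mono S₃.f, Category.assoc, ψ.comm₁₂, reassoc_of% hx, ← hpr₂,
              reassoc_of% hk₂, zero_comp]
          refine ⟨c₁.exact.lift x hx', ?_⟩
          have hy : c₁.exact.lift x hx' ≫ φ.τ₁ = x := c₁.exact.lift_f _ _
          dsimp [Θ]
          rw [hs, reassoc_of% hy, ← cancel_mono ι, Category.assoc, hs₂, hx]
      mono_f := by
        have : Mono s₁ := mono_of_mono_fac hs₁
        exact inferInstanceAs (Mono (S₁.f ≫ s₁))
      epi_g := by
        have : biprod.desc s₁ s₂ ≫ biprod.lift pr₁ pr₂ = biprod.map S₁.g ψ.τ₁ := by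
          ext <;> simp [h₁₁, h₁₂, h₂₁, h₂₂]
        exact epi_of_epi_fac this }
  have e₁ : (Ext.mk₀ biprod.inl).comp hΘ.extClass (zero_add 1) = r₁.extClass := by
    let χ : S₁ ⟶ Θ :=
      { τ₁ := 𝟙 _
        τ₂ := s₁
        τ₃ := biprod.inl
        comm₁₂ := by simp [Θ]
        comm₂₃ := by ext <;> simp [Θ, h₁₁, h₁₂] }
    exact (r₁.extClass_naturality hΘ χ).symm.trans (Ext.comp_mk₀_id _)
  have e₂ : (Ext.mk₀ biprod.inr).comp hΘ.extClass (zero_add 1) = c₁.extClass := by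
    let χ : ShortComplex.mk φ.τ₁ ψ.τ₁ z₁ ⟶ Θ :=
      { τ₁ := 𝟙 _
        τ₂ := s₂
        τ₃ := biprod.inr
        comm₁₂ := by simp [Θ, hs]
        comm₂₃ := by ext <;> simp [Θ, h₂₁, h₂₂] }
    exact (c₁.extClass_naturality hΘ χ).symm.trans (Ext.comp_mk₀_id _)
  have e₃ : hS.extClass.comp (Ext.mk₀ pr₁) (add_zero 1) = c₃.extClass := by
    let χ : S ⟶ ShortComplex.mk φ.τ₃ ψ.τ₃ z₃ :=
      { τ₁ := pr₁
        τ₂ := S₂.g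
        τ₃ := 𝟙 _
        comm₁₂ := hpr₁
        comm₂₃ := by simp [S, d] }
    exact (hS.extClass_naturality c₃ χ).trans (Ext.mk₀_id_comp _)
  have e₄ : hS.extClass.comp (Ext.mk₀ pr₂) (add_zero 1) = r₃.extClass := by
    let χ : S ⟶ S₃ :=
      { τ₁ := pr₂
        τ₂ := ψ.τ₂
        τ₃ := 𝟙 _
        comm₁₂ := hpr₂
        comm₂₃ := by simp [S, hd] }
    exact (hS.extClass_naturality r₃ χ).trans (Ext.mk₀_id_comp _)
  have key : (Ext.mk₀ pr₁).comp r₁.extClass (zero_add 1) +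
      (Ext.mk₀ pr₂).comp c₁.extClass (zero_add 1) = 0 := by
    rw [← e₁, ← e₂, Ext.mk₀_comp_mk₀_assoc, Ext.mk₀_comp_mk₀_assoc, ← Ext.add_comp, ← Ext.mk₀_add]
    exact (congrArg (fun t ↦ (Ext.mk₀ t).comp hΘ.extClass (zero_add 1))
      (by ext <;> simp [Θ])).trans hΘ.comp_extClass
  rw [eq_neg_iff_add_eq_zero, ← e₃, ← e₄, Ext.comp_assoc_of_second_deg_zero,
    Ext.comp_assoc_of_second_deg_zero, ← Ext.comp_add, key, Ext.comp_zero]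

namespace Abelian.Ext

lemma comp_zsmul {X Y Z : C} {a b c : ℕ} (α : Ext X Y a) (r : ℤ) (β : Ext Y Z b)
    (h : a + b = c) : α.comp (r • β) h = r • α.comp β h :=
  map_zsmul (α.precomp Z h) r β

lemma zsmul_comp {X Y Z : C} {a b c : ℕ} (r : ℤ) (α : Ext X Y a) (β : Ext Y Z b)
    (h : a + b = c) : (r • α).comp β h = r • α.comp β h :=
  map_zsmul (β.postcomp X h) r α

lemma exists_extClass_comp_of_projective {S : ShortComplex C} (hS : S.ShortExact)
    [Projective S.X₂] {Y : C} {n : ℕ} (f : Ext S.X₃ Y (n + 1)) :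
    ∃ f' : Ext S.X₁ Y n, hS.extClass.comp f' (add_comm 1 n) = f :=
  contravariant_sequence_exact₃ hS Y f (eq_zero_of_projective _) (add_comm 1 n)

variable {D : Type u'} [Category.{v'} D] [Abelian D] [HasExt.{w} D] [EnoughProjectives C]

lemma mapExactFunctor_comp_mk₀_app {F G : C ⥤ D} [F.Additive] [PreservesFiniteLimits F]
    [PreservesFiniteColimits F] [G.Additive] [PreservesFiniteLimits G]
    [PreservesFiniteColimits G] (τ : F ⟶ G) {X Y : C} {n : ℕ} (f : Ext X Y n) :
    (f.mapExactFunctor F).comp (mk₀ (τ.app Y)) (add_zero n) =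
      (mk₀ (τ.app X)).comp (f.mapExactFunctor G) (zero_add n) := by
  induction n generalizing X with
  | zero =>
    obtain ⟨φ, rfl⟩ := (mk₀_bijective X Y).2 f
    simp [mapExactFunctor_mk₀]
  | succ n ih =>
    let S : ShortComplex C := .mk (kernel.ι (Projective.π X)) (Projective.π X) (kernel.condition _)
    have hS : S.ShortExact := { exact := ShortComplex.exact_kernel _ }
    have : Projective S.X₂ := inferInstanceAs (Projective (Projective.over X))
    obtain ⟨f, rfl⟩ := exists_extClass_comp_of_projective hS f
    have nat : (hS.extClass.mapExactFunctor F).comp (mk₀ (τ.app S.X₁)) (add_zero 1) =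
        (mk₀ (τ.app X)).comp (hS.extClass.mapExactFunctor G) (zero_add 1) := by
      rw [mapExactFunctor_extClass, mapExactFunctor_extClass]
      exact (hS.map_of_exact F).extClass_naturality (hS.map_of_exact G) (S.mapNatTrans τ)
    rw [mapExactFunctor_comp, mapExactFunctor_comp, comp_assoc_of_third_deg_zero, ih,
      ← comp_assoc_of_second_deg_zero, nat]
    exact comp_assoc _ _ _ _ _ (by lia)

lemma mapExactFunctor_id {X Y : C} {n : ℕ} (f : Ext X Y n) : f.mapExactFunctor (𝟭 C) = f := by
  induction n generalizing X with
  | zero =>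
    obtain ⟨φ, rfl⟩ := (mk₀_bijective X Y).2 f
    simp [mapExactFunctor_mk₀]
  | succ n ih =>
    let S : ShortComplex C := .mk (kernel.ι (Projective.π X)) (Projective.π X) (kernel.condition _)
    have hS : S.ShortExact := { exact := ShortComplex.exact_kernel _ }
    have : Projective S.X₂ := inferInstanceAs (Projective (Projective.over X))
    obtain ⟨f, rfl⟩ := exists_extClass_comp_of_projective hS f
    rw [mapExactFunctor_comp, ih, mapExactFunctor_extClass]
    rfl

/-- The connecting class of a pointwise short exact sequence of exact functors is natural with
respect to classes of degree `n`, up to the sign `(-1) ^ n`. -/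
lemma extClass_comp_mapExactFunctor {F₁ F₂ F₃ : C ⥤ D}
    [F₁.Additive] [PreservesFiniteLimits F₁] [PreservesFiniteColimits F₁]
    [F₂.Additive] [PreservesFiniteLimits F₂] [PreservesFiniteColimits F₂]
    [F₃.Additive] [PreservesFiniteLimits F₃] [PreservesFiniteColimits F₃]
    (α : F₁ ⟶ F₂) (β : F₂ ⟶ F₃) (z : ∀ X, α.app X ≫ β.app X = 0)
    (h : ∀ X, (ShortComplex.mk _ _ (z X)).ShortExact) {X Y : C} {n m : ℕ} (hm : n + 1 = m)
    (f : Ext X Y n) :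
    (h X).extClass.comp (f.mapExactFunctor F₁) ((add_comm 1 n).trans hm) =
      (-1 : ℤ) ^ n • (f.mapExactFunctor F₃).comp (h Y).extClass hm := by
  induction n generalizing X m with
  | zero =>
    obtain rfl : 1 = m := hm
    obtain ⟨φ, rfl⟩ := (mk₀_bijective X Y).2 f
    let χ : ShortComplex.mk _ _ (z X) ⟶ ShortComplex.mk _ _ (z Y) :=
      { τ₁ := F₁.map φ
        τ₂ := F₂.map φ
        τ₃ := F₃.map φ }
    simpa [mapExactFunctor_mk₀] using (h X).extClass_naturality (h Y) χ
  | succ n ih =>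
    let S : ShortComplex C := .mk (kernel.ι (Projective.π X)) (Projective.π X) (kernel.condition _)
    have hS : S.ShortExact := { exact := ShortComplex.exact_kernel _ }
    have : Projective S.X₂ := inferInstanceAs (Projective (Projective.over X))
    obtain ⟨f, rfl⟩ := exists_extClass_comp_of_projective hS f
    have key : (h X).extClass.comp (hS.extClass.mapExactFunctor F₁) (c := 2) rfl =
        -(hS.extClass.mapExactFunctor F₃).comp (h S.X₁).extClass (c := 2) rfl := by
      rw [mapExactFunctor_extClass, mapExactFunctor_extClass]
      exact ShortComplex.extClass_comp_extClass_of_three_by_three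
        (S.mapNatTrans α) (S.mapNatTrans β) (z _) (z _) (z _) (hS.map_of_exact F₁)
        (hS.map_of_exact F₂) (hS.map_of_exact F₃) (h S.X₁) (h S.X₂) (h S.X₃)
    have assoc₁ : (h X).extClass.comp ((hS.extClass.mapExactFunctor F₁).comp
        (f.mapExactFunctor F₁) (add_comm 1 n)) ((add_comm 1 (n + 1)).trans hm) =
        ((h X).extClass.comp (hS.extClass.mapExactFunctor F₁) (c := 2) rfl).comp
          (f.mapExactFunctor F₁) (by lia) := (comp_assoc _ _ _ _ _ (by lia)).symm
    have assoc₂ : ((hS.extClass.mapExactFunctor F₃).comp (h S.X₁).extClass (c := 2) rfl).comp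
        (f.mapExactFunctor F₁) (show 2 + n = m by lia) =
        (hS.extClass.mapExactFunctor F₃).comp
          ((h S.X₁).extClass.comp (f.mapExactFunctor F₁) (add_comm 1 n)) (by lia) :=
      comp_assoc _ _ _ _ _ (by lia)
    have assoc₃ : ((hS.extClass.mapExactFunctor F₃).comp (f.mapExactFunctor F₃)
        (add_comm 1 n)).comp (h Y).extClass hm = (hS.extClass.mapExactFunctor F₃).comp
          ((f.mapExactFunctor F₃).comp (h Y).extClass rfl) (by lia) :=
      comp_assoc _ _ _ _ _ (by lia)
    rw [mapExactFunctor_comp, mapExactFunctor_comp, assoc₁, key, neg_comp, assoc₂, ih rfl,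
      comp_zsmul, assoc₃, pow_succ, mul_neg_one, neg_smul]

variable [MonoidalCategory C] [MonoidalPreadditive C]

/-- Let `P` be a class of flat objects of an abelian monoidal category such that every object of
`P` has a projective presentation that stays in `P` and in short exact sequences after tensoring.
Then the product of a class `f` from `X` to the unit with a class `g` on the unit can be computed,
up to sign, with the tensor product `X ⊗ g`. -/
lemma mk₀_rightUnitor_comp_comp (P : ObjectProperty C)
    (hP : ∀ X, P X → PreservesFiniteLimits (tensorLeft X) ∧ PreservesFiniteColimits (tensorLeft X))
    (hP' : ∀ X, P X → ∃ (K L : C) (i : K ⟶ L) (π : L ⟶ X) (z : i ≫ π = 0),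
      Projective L ∧ P K ∧ P L ∧
        ∀ Y, (ShortComplex.mk (i ▷ Y) (π ▷ Y)
          (by rw [← comp_whiskerRight, z, MonoidalPreadditive.zero_whiskerRight])).ShortExact)
    {X : C} (hX : P X) [PreservesFiniteLimits (tensorLeft X)]
    [PreservesFiniteColimits (tensorLeft X)] {p q n : ℕ} (h : p + q = n)
    (f : Ext X (𝟙_ C) p) (g : Ext (𝟙_ C) (𝟙_ C) q) :
    (mk₀ (ρ_ X).hom).comp (f.comp g h) (zero_add n) = (-1 : ℤ) ^ (p * q) •
      (g.mapExactFunctor (tensorLeft X)).comp ((mk₀ (ρ_ X).hom).comp f (zero_add p))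
        ((add_comm q p).trans h) := by
  induction p generalizing X n with
  | zero =>
    obtain rfl : q = n := by lia
    obtain ⟨φ, rfl⟩ := (mk₀_bijective X (𝟙_ C)).2 f
    let τ : tensorLeft X ⟶ 𝟭 C :=
      { app Y := φ ▷ Y ≫ (λ_ Y).hom
        naturality Y Z f := by simp [whisker_exchange_assoc] }
    have key := mapExactFunctor_comp_mk₀_app τ g
    rw [mapExactFunctor_id] at key
    have hτ : (ρ_ X).hom ≫ φ = τ.app (𝟙_ C) := by simp [τ, unitors_equal]
    rw [mk₀_comp_mk₀_assoc, mk₀_comp_mk₀, hτ, zero_mul, pow_zero, one_smul]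
    exact key.symm
  | succ p ih =>
    obtain ⟨K, L, i, π, z, hL, hK, hL', hS⟩ := hP' X hX
    obtain ⟨_, _⟩ := hP K hK
    obtain ⟨_, _⟩ := hP L hL'
    have hT : (ShortComplex.mk i π z).ShortExact :=
      ShortComplex.shortExact_of_iso (ShortComplex.isoMk (ρ_ _) (ρ_ _) (ρ_ _)) (hS (𝟙_ C))
    have : Projective (ShortComplex.mk i π z).X₂ := hL
    obtain ⟨f, rfl⟩ := exists_extClass_comp_of_projective hT f
    have key : (hS (𝟙_ C)).extClass.comp (g.mapExactFunctor (tensorLeft K)) (add_comm 1 q) =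
        (-1 : ℤ) ^ q • (g.mapExactFunctor (tensorLeft X)).comp (hS (𝟙_ C)).extClass rfl :=
      extClass_comp_mapExactFunctor (F₁ := tensorLeft K) (F₂ := tensorLeft L)
        (F₃ := tensorLeft X) ((curriedTensor C).map i) ((curriedTensor C).map π) _ hS rfl g
    have nat : (hS (𝟙_ C)).extClass.comp (mk₀ (ρ_ K).hom) (add_zero 1) =
        (mk₀ (ρ_ X).hom).comp hT.extClass (zero_add 1) :=
      (hS (𝟙_ C)).extClass_naturality hT
        { τ₁ := (ρ_ K).hom
          τ₂ := (ρ_ L).hom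
          τ₃ := (ρ_ X).hom }
    have nat' {n m : ℕ} (h : 1 + n = m) (e : Ext K (𝟙_ C) n) :
        (mk₀ (ρ_ X).hom).comp (hT.extClass.comp e h) (zero_add m) =
          (hS (𝟙_ C)).extClass.comp ((mk₀ (ρ_ K).hom).comp e (zero_add n)) h := by
      rw [← comp_assoc_of_second_deg_zero, nat]
      exact (comp_assoc _ _ _ _ _ (by lia)).symm
    have assoc₁ : (hT.extClass.comp f (add_comm 1 p)).comp g h =
        hT.extClass.comp (f.comp g rfl) (by lia) := comp_assoc _ _ _ _ _ (by lia)
    have assoc₂ (a : Ext (X ⊗ 𝟙_ C) (X ⊗ 𝟙_ C) q) (b : Ext (X ⊗ 𝟙_ C) (K ⊗ 𝟙_ C) 1)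
        (c : Ext (K ⊗ 𝟙_ C) (𝟙_ C) p) : (a.comp b rfl).comp c (show q + 1 + p = n by lia) =
        a.comp (b.comp c (add_comm 1 p)) (by lia) := comp_assoc _ _ _ _ _ (by lia)
    have assoc₃ (a : Ext (X ⊗ 𝟙_ C) (K ⊗ 𝟙_ C) 1) (b : Ext (K ⊗ 𝟙_ C) (K ⊗ 𝟙_ C) q)
        (c : Ext (K ⊗ 𝟙_ C) (𝟙_ C) p) : a.comp (b.comp c (add_comm q p)) (show _ = n by lia) =
        (a.comp b (add_comm 1 q)).comp c (by lia) := (comp_assoc _ _ _ _ _ (by lia)).symm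
    have step := nat' (show 1 + (p + q) = n by lia) (f.comp g rfl)
    rw [ih hK rfl f, comp_zsmul] at step
    rw [assoc₁, step]
    refine Eq.trans (congrArg _ (assoc₃ _ _ _)) ?_
    rw [key, zsmul_comp, nat' (add_comm 1 p) f, smul_smul, ← pow_add, add_one_mul]
    exact congrArg _ (assoc₂ _ _ _)

/-- Under the same assumptions, the Yoneda algebra of the unit is graded-commutative as soon as the
unit belongs to `P`. -/
theorem comp_eq_zsmul_comp_of_tensorUnit (P : ObjectProperty C)
    (hP : ∀ X, P X → PreservesFiniteLimits (tensorLeft X) ∧ PreservesFiniteColimits (tensorLeft X))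
    (hP' : ∀ X, P X → ∃ (K L : C) (i : K ⟶ L) (π : L ⟶ X) (z : i ≫ π = 0),
      Projective L ∧ P K ∧ P L ∧
        ∀ Y, (ShortComplex.mk (i ▷ Y) (π ▷ Y)
          (by rw [← comp_whiskerRight, z, MonoidalPreadditive.zero_whiskerRight])).ShortExact)
    (hunit : P (𝟙_ C)) {p q n : ℕ} (h : p + q = n)
    (f : Ext (𝟙_ C) (𝟙_ C) p) (g : Ext (𝟙_ C) (𝟙_ C) q) :
    f.comp g h = (-1 : ℤ) ^ (p * q) • g.comp f ((add_comm q p).trans h) := by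
  obtain ⟨_, _⟩ := hP _ hunit
  have key := mk₀_rightUnitor_comp_comp P hP hP' hunit h f g
  have nat := mapExactFunctor_comp_mk₀_app (leftUnitorNatIso C).hom g
  have nat' : (g.mapExactFunctor (tensorLeft (𝟙_ C))).comp (mk₀ (ρ_ (𝟙_ C)).hom) (add_zero q) =
      (mk₀ (ρ_ (𝟙_ C)).hom).comp g (zero_add q) := by
    rw [mapExactFunctor_id] at nat
    rw [← unitors_equal]
    exact nat
  have e : (g.mapExactFunctor (tensorLeft (𝟙_ C))).comp
      ((mk₀ (ρ_ (𝟙_ C)).hom).comp f (zero_add p)) ((add_comm q p).trans h) =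
      (mk₀ (ρ_ (𝟙_ C)).hom).comp (g.comp f ((add_comm q p).trans h)) (zero_add n) := by
    refine (comp_assoc_of_second_deg_zero _ _ _ _).symm.trans ?_
    rw [nat']
    exact comp_assoc _ _ _ _ _ (by lia)
  rw [e] at key
  have := congrArg (fun t ↦ (mk₀ (ρ_ (𝟙_ C)).inv).comp t (zero_add n)) key
  simpa [comp_zsmul] using this

end Abelian.Ext

end

end CategoryTheory

namespace Rep

open Limits MonoidalCategory

variable {k G : Type u} [CommRing k] [Group G]

lemma exact_iff {S : ShortComplex (Rep.{u} k G)} :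
    S.Exact ↔ Function.Exact S.f.hom S.g.hom := by
  rw [← S.exact_map_iff_of_faithful (forget₂ (Rep k G) (ModuleCat k)),
    ShortComplex.ShortExact.moduleCat_exact_iff_function_exact]
  rfl

lemma shortExact_iff {S : ShortComplex (Rep.{u} k G)} :
    S.ShortExact ↔ Function.Injective S.f.hom ∧ Function.Exact S.f.hom S.g.hom ∧
      Function.Surjective S.g.hom := by
  rw [← mono_iff_injective, ← epi_iff_surjective, ← exact_iff]
  exact ⟨fun h ↦ ⟨h.mono_f, h.exact, h.epi_g⟩,
    fun h ↦ { exact := h.2.1, mono_f := h.1, epi_g := h.2.2 }⟩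

lemma preservesFiniteLimits_tensorLeft (X : Rep.{u} k G) [Module.Flat k X] :
    PreservesFiniteLimits (tensorLeft X) := by
  have h : (∀ S : ShortComplex (Rep k G), S.ShortExact → (S.map (tensorLeft X)).ShortExact) ↔
      PreservesFiniteLimits (tensorLeft X) ∧ PreservesFiniteColimits (tensorLeft X) :=
    (Functor.exact_tfae (tensorLeft X)).out 0 3
  refine (h.1 fun S hS ↦ ?_).1
  rw [shortExact_iff] at hS ⊢
  exact ⟨Module.Flat.lTensor_preserves_injective_linearMap S.f.hom.toLinearMap hS.1,
    lTensor_exact X (f := S.f.hom.toLinearMap) (g := S.g.hom.toLinearMap) hS.2.1 hS.2.2,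
    LinearMap.lTensor_surjective X (g := S.g.hom.toLinearMap) hS.2.2⟩

lemma exists_leftInverse_of_shortExact {S : ShortComplex (Rep.{u} k G)} (hS : S.ShortExact)
    [Module.Projective k S.X₃] :
    ∃ l : S.X₂ →ₗ[k] S.X₁, l ∘ₗ S.f.hom.toLinearMap = LinearMap.id := by
  obtain ⟨hf, hfg, hg⟩ := shortExact_iff.1 hS
  exact ((Function.Exact.split_tfae (f := S.f.hom.toLinearMap) (g := S.g.hom.toLinearMap)
    hfg hf hg).out 0 1).1 (Module.projective_lifting_property S.g.hom.toLinearMap LinearMap.id hg)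

lemma shortExact_map_tensorRight {S : ShortComplex (Rep.{u} k G)} (hS : S.ShortExact)
    [Module.Projective k S.X₃] (Y : Rep.{u} k G) : (S.map (tensorRight Y)).ShortExact := by
  obtain ⟨l, hl⟩ := exists_leftInverse_of_shortExact hS
  rw [shortExact_iff] at hS ⊢
  obtain ⟨hf, hfg, hg⟩ := hS
  refine ⟨Function.LeftInverse.injective (g := l.rTensor Y) fun x ↦ ?_,
    rTensor_exact Y (f := S.f.hom.toLinearMap) (g := S.g.hom.toLinearMap) hfg hg,
    LinearMap.rTensor_surjective Y (g := S.g.hom.toLinearMap) hg⟩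
  change (l.rTensor Y ∘ₗ S.f.hom.toLinearMap.rTensor Y) x = x
  rw [← LinearMap.rTensor_comp, hl, LinearMap.rTensor_id, LinearMap.id_apply]

/-- Every representation that is projective over `k` is a quotient of a projective representation
with a `k`-projective kernel. -/
lemma exists_shortExact_projective (X : Rep.{u} k G) [Module.Projective k X] :
    ∃ (K P : Rep.{u} k G) (i : K ⟶ P) (p : P ⟶ X) (w : i ≫ p = 0),
      (ShortComplex.mk i p w).ShortExact ∧ Projective P ∧
        Module.Projective k P ∧ Module.Projective k K := by
  let p : free k G X ⟶ X := freeLift k G X id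
  have hp : Function.Surjective p.hom := fun x ↦ ⟨Finsupp.single x (MonoidAlgebra.single 1 1), by
    simp [p]⟩
  have : Epi p := (epi_iff_surjective p).2 hp
  have h : (ShortComplex.mk _ _ (kernel.condition p)).ShortExact :=
    { exact := ShortComplex.exact_kernel _ }
  have : Module.Projective k (free k G X) :=
    inferInstanceAs (Module.Projective k (X →₀ MonoidAlgebra k G))
  refine ⟨_, _, _, _, _, h, inferInstance, this, ?_⟩
  obtain ⟨l, hl⟩ := exists_leftInverse_of_shortExact h
  exact Module.Projective.of_split _ l hl

end Rep

/-- Group cohomology is graded-commutative: for a commutative ring `k` and a group `G`, the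
Yoneda Ext algebra `Ext^*_{Rep k G}(k, k)` of the trivial representation is graded-commutative:
for `f ∈ Ext^p(k, k)` and `g ∈ Ext^q(k, k)`, one has `g ∘ f = (-1)^{pq} f ∘ g`, where the
Yoneda product of Ext classes is given by composition (`f.comp g` is `g ∘ f`). -/
theorem rep_ext_graded_comm (k G : Type u) [CommRing k] [Group G] (p q : ℕ) :
    letI : HasDerivedCategory (Rep k G) := HasDerivedCategory.standard _
    letI : HasExt (Rep k G) := hasExt_of_hasDerivedCategory _
    ∀ (f : Ext (Rep.trivial k G k) (Rep.trivial k G k) p)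
      (g : Ext (Rep.trivial k G k) (Rep.trivial k G k) q),
      f.comp g rfl = ((-1 : ℤ) ^ (p * q)) • g.comp f (by omega) := by
  intro f g
  let : HasDerivedCategory (Rep k G) := HasDerivedCategory.standard _
  let : HasExt (Rep k G) := hasExt_of_hasDerivedCategory _
  refine Ext.comp_eq_zsmul_comp_of_tensorUnit (C := Rep.{u} k G) (fun X ↦ Module.Projective k X)
    (fun X hX ↦ ⟨Rep.preservesFiniteLimits_tensorLeft X, inferInstance⟩) (fun X hX ↦ ?_)
    (inferInstanceAs (Module.Projective k k)) rfl f g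
  obtain ⟨K, P, i, p, w, h, hP, hP', hK⟩ := Rep.exists_shortExact_projective X
  exact ⟨K, P, i, p, w, hP, hK, hP', Rep.shortExact_map_tensorRight h⟩
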